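/- Let Φ be an m×N complex matrix with restricted isometry constant δ_{4s}(Φ) ≤ 0.1, let x ∈ ℂ^N be s-sparse, let e ∈ ℂ^m be arbitrary, let u = Φx + e, and let (a^k) be the sequence of approximations produced by CoSaMP with sparsity level s. Then for every k ≥ 0, a^k is s-sparse and ‖x − a^{k+1}‖₂ ≤ 0.5·‖x − a^k‖₂ + 7.5·‖e‖₂. -/

import Mathlib

open Matrix
open scoped BigOperators Classical

/-- The Euclidean (ℓ₂) norm of a finitely indexed complex vector. -/
noncomputable def l2 {ι : Type*} [Fintype ι] (x : ι → ℂ) : ℝ :=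
  Real.sqrt (∑ i, ‖x i‖ ^ 2)

/-- The ℓ₁ norm of a finitely indexed complex vector. -/
noncomputable def l1 {ι : Type*} [Fintype ι] (x : ι → ℂ) : ℝ := ∑ i, ‖x i‖

/-- The ℓ∞ (supremum) norm of a finitely indexed complex vector. -/
noncomputable def linf {ι : Type*} [Fintype ι] (x : ι → ℂ) : ℝ := ⨆ i, ‖x i‖

/-- The support of a vector, as a finite set of coordinates. -/
noncomputable def suppF {N : ℕ} (x : Fin N → ℂ) : Finset (Fin N) :=
  Finset.univ.filter fun i => x i ≠ 0

/-- A vector is `s`-sparse when it has at most `s` nonzero entries. -/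
def Sparse {N : ℕ} (s : ℕ) (x : Fin N → ℂ) : Prop := (suppF x).card ≤ s

/-- Restriction of a vector to a set `T` of coordinates: equal to `x` on `T`, zero off `T`. -/
noncomputable def restrictTo {N : ℕ} (x : Fin N → ℂ) (T : Finset (Fin N)) : Fin N → ℂ :=
  fun i => if i ∈ T then x i else 0

/-- `y` is a best `s`-sparse approximation of `x`: it agrees with `x` on a set of `s`
coordinates of largest magnitude and vanishes elsewhere. -/
def IsSparseApprox {N : ℕ} (s : ℕ) (x y : Fin N → ℂ) : Prop :=
  ∃ T : Finset (Fin N), T.card = min s N ∧ y = restrictTo x T ∧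
    ∀ i ∈ T, ∀ j ∉ T, ‖x j‖ ≤ ‖x i‖

/-- The `r`-th restricted isometry constant of `Φ`: the least `δ ≥ 0` such that
`(1-δ)‖x‖² ≤ ‖Φx‖² ≤ (1+δ)‖x‖²` for all `r`-sparse `x`. -/
noncomputable def RIC {m N : ℕ} (Φ : Matrix (Fin m) (Fin N) ℂ) (r : ℕ) : ℝ :=
  sInf {δ : ℝ | 0 ≤ δ ∧ ∀ x : Fin N → ℂ, Sparse r x →
    (1 - δ) * l2 x ^ 2 ≤ l2 (Φ.mulVec x) ^ 2 ∧ l2 (Φ.mulVec x) ^ 2 ≤ (1 + δ) * l2 x ^ 2}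

/-- The column submatrix of `Φ` with columns indexed by the finite set `T`. -/
noncomputable def colSub {m N : ℕ} (Φ : Matrix (Fin m) (Fin N) ℂ) (T : Finset (Fin N)) :
    Matrix (Fin m) {i // i ∈ T} ℂ :=
  Matrix.of fun r c => Φ r c.1

/-- The least-squares estimate `Φ_T† u = (Φ_T* Φ_T)⁻¹ Φ_T* u`, viewed as a vector in `ℂ^N`
supported on `T`. -/
noncomputable def pinvApply {m N : ℕ} (Φ : Matrix (Fin m) (Fin N) ℂ) (T : Finset (Fin N))
    (u : Fin m → ℂ) : Fin N → ℂ :=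
  fun j =>
    if h : j ∈ T then (((colSub Φ T)ᴴ * colSub Φ T)⁻¹ * (colSub Φ T)ᴴ).mulVec u ⟨j, h⟩
    else 0

/-- One iteration of CoSaMP with samples `u` and sparsity level `s`, mapping the current
approximation `a` to the next approximation `a'`. -/
def CoSaMPStep {m N : ℕ} (Φ : Matrix (Fin m) (Fin N) ℂ) (u : Fin m → ℂ) (s : ℕ)
    (a a' : Fin N → ℂ) : Prop :=
  ∃ y2s : Fin N → ℂ,
    IsSparseApprox (2 * s) (Φᴴ.mulVec (u - Φ.mulVec a)) y2s ∧
    IsSparseApprox s (pinvApply Φ (suppF y2s ∪ suppF a) u) a'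

/-- `a` is a sequence of approximations produced by CoSaMP: `a 0 = 0` and each successive
approximation arises from one CoSaMP iteration. -/
def CoSaMPSeq {m N : ℕ} (Φ : Matrix (Fin m) (Fin N) ℂ) (u : Fin m → ℂ) (s : ℕ)
    (a : ℕ → Fin N → ℂ) : Prop :=
  a 0 = 0 ∧ ∀ k, CoSaMPStep Φ u s (a k) (a (k + 1))

/-- The spectral norm (ℓ₂ → ℓ₂ operator norm) of a matrix. -/
noncomputable def specNorm {a b : Type*} [Fintype a] [Fintype b] (M : Matrix a b ℂ) : ℝ :=
  sSup ((fun x => l2 (M.mulVec x)) '' {x | l2 x ≤ 1})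

/-- The ℓ₂ norm is the norm of the Euclidean space on the same index type. -/
lemma l2_eq_norm {ι : Type*} [Fintype ι] (x : ι → ℂ) : l2 x = ‖WithLp.toLp 2 x‖ := by
  simp [l2, EuclideanSpace.norm_eq]

lemma l2_nonneg {ι : Type*} [Fintype ι] (x : ι → ℂ) : 0 ≤ l2 x := Real.sqrt_nonneg _

lemma l2_sq {ι : Type*} [Fintype ι] (x : ι → ℂ) : l2 x ^ 2 = ∑ i, ‖x i‖ ^ 2 :=
  Real.sq_sqrt (Finset.sum_nonneg fun _ _ => sq_nonneg _)

lemma l2_add_le {ι : Type*} [Fintype ι] (x y : ι → ℂ) : l2 (x + y) ≤ l2 x + l2 y := by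
  simpa only [l2_eq_norm, WithLp.toLp_add] using norm_add_le _ _

lemma l2_neg {ι : Type*} [Fintype ι] (x : ι → ℂ) : l2 (-x) = l2 x := by
  simp [l2]

lemma l2_smul {ι : Type*} [Fintype ι] (c : ℝ) (x : ι → ℂ) : l2 ((c : ℂ) • x) = |c| * l2 x := by
  rw [l2_eq_norm, l2_eq_norm, WithLp.toLp_smul, norm_smul]
  simp

lemma l2_eq_zero {ι : Type*} [Fintype ι] {x : ι → ℂ} : l2 x = 0 ↔ x = 0 := by
  rw [l2_eq_norm, norm_eq_zero, WithLp.toLp_eq_zero]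

lemma l2_le_l2_of_norm_le {ι : Type*} [Fintype ι] {x y : ι → ℂ} (h : ∀ i, ‖x i‖ ≤ ‖y i‖) :
    l2 x ≤ l2 y := by
  refine Real.sqrt_le_sqrt (Finset.sum_le_sum fun i _ => ?_)
  gcongr
  exact h i

lemma re_dotProduct_le_l2_mul {ι : Type*} [Fintype ι] (x y : ι → ℂ) :
    (star x ⬝ᵥ y).re ≤ l2 x * l2 y := by
  have h := re_inner_le_norm (𝕜 := ℂ) (WithLp.toLp 2 x) (WithLp.toLp 2 y)
  rw [EuclideanSpace.inner_toLp_toLp, dotProduct_comm] at h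
  rw [l2_eq_norm, l2_eq_norm]
  exact h

lemma l2_sq_eq_re_dotProduct {ι : Type*} [Fintype ι] (x : ι → ℂ) :
    l2 x ^ 2 = (star x ⬝ᵥ x).re := by
  have h := inner_self_eq_norm_sq (𝕜 := ℂ) (WithLp.toLp 2 x)
  rw [EuclideanSpace.inner_toLp_toLp, dotProduct_comm] at h
  rw [l2_eq_norm]
  exact h.symm

lemma l2_add_sq {ι : Type*} [Fintype ι] (x y : ι → ℂ) :
    l2 (x + y) ^ 2 = l2 x ^ 2 + 2 * (star x ⬝ᵥ y).re + l2 y ^ 2 := by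
  have h := norm_add_sq (𝕜 := ℂ) (WithLp.toLp 2 x) (WithLp.toLp 2 y)
  rw [EuclideanSpace.inner_toLp_toLp, dotProduct_comm] at h
  rw [l2_eq_norm, l2_eq_norm, l2_eq_norm, WithLp.toLp_add]
  exact h

lemma l2_sub_sq {ι : Type*} [Fintype ι] (x y : ι → ℂ) :
    l2 (x - y) ^ 2 = l2 x ^ 2 - 2 * (star x ⬝ᵥ y).re + l2 y ^ 2 := by
  rw [sub_eq_add_neg, l2_add_sq, l2_neg, dotProduct_neg, Complex.neg_re]
  ring

lemma mem_suppF {N : ℕ} {x : Fin N → ℂ} {i : Fin N} : i ∈ suppF x ↔ x i ≠ 0 := by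
  simp [suppF]

lemma Sparse.of_suppF_subset {N s : ℕ} {x : Fin N → ℂ} {S : Finset (Fin N)}
    (h : suppF x ⊆ S) (hS : S.card ≤ s) : Sparse s x :=
  (Finset.card_le_card h).trans hS

lemma suppF_restrictTo_subset {N : ℕ} (x : Fin N → ℂ) (T : Finset (Fin N)) :
    suppF (restrictTo x T) ⊆ T := by
  intro i hi
  by_contra h
  exact mem_suppF.1 hi (by simp [restrictTo, h])

lemma suppF_sub_subset {N : ℕ} (x y : Fin N → ℂ) : suppF (x - y) ⊆ suppF x ∪ suppF y := by
  intro i hi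
  by_contra h
  simp only [Finset.mem_union, mem_suppF, not_or, not_not] at h
  exact mem_suppF.1 hi (by simp [h.1, h.2])

lemma l2_restrictTo_sq {N : ℕ} (x : Fin N → ℂ) (T : Finset (Fin N)) :
    l2 (restrictTo x T) ^ 2 = ∑ i ∈ T, ‖x i‖ ^ 2 := by
  simp [l2_sq, restrictTo, apply_ite, Finset.sum_ite_mem]

lemma restrictTo_add {N : ℕ} (x y : Fin N → ℂ) (T : Finset (Fin N)) :
    restrictTo (x + y) T = restrictTo x T + restrictTo y T := by
  ext i
  by_cases h : i ∈ T <;> simp [restrictTo, h]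

lemma IsSparseApprox.sparse {N s : ℕ} {x y : Fin N → ℂ} (h : IsSparseApprox s x y) :
    Sparse s y := by
  obtain ⟨T, hT, rfl, -⟩ := h
  exact .of_suppF_subset (suppF_restrictTo_subset _ _) (hT.trans_le (min_le_left _ _))

lemma IsSparseApprox.eq_restrictTo_suppF {N s : ℕ} {x y : Fin N → ℂ}
    (h : IsSparseApprox s x y) : y = restrictTo x (suppF y) := by
  obtain ⟨T, -, rfl, -⟩ := h
  ext i
  by_cases hi : i ∈ T <;> by_cases h0 : x i = 0 <;> simp [restrictTo, suppF, hi, h0]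

/-- A best `s`-sparse approximation captures at least as much energy as any `s` coordinates. -/
lemma IsSparseApprox.sum_le_l2_sq {N s : ℕ} {x y : Fin N → ℂ} (h : IsSparseApprox s x y)
    {R : Finset (Fin N)} (hR : R.card ≤ s) : ∑ i ∈ R, ‖x i‖ ^ 2 ≤ l2 y ^ 2 := by
  obtain ⟨T, hT, rfl, hmax⟩ := h
  have hcard : (R \ T).card ≤ (T \ R).card := by
    have h1 := Finset.card_sdiff_add_card_inter R T
    have h2 := Finset.card_sdiff_add_card_inter T R
    have h3 : R.card ≤ N := by simpa using Finset.card_le_univ R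
    rw [Finset.inter_comm] at h2
    omega
  have key : ∑ i ∈ R \ T, ‖x i‖ ^ 2 ≤ ∑ i ∈ T \ R, ‖x i‖ ^ 2 := by
    rcases (R \ T).eq_empty_or_nonempty with h0 | hne
    · rw [h0, Finset.sum_empty]
      positivity
    · obtain ⟨j, hj, hjmax⟩ := Finset.exists_max_image _ (fun i => ‖x i‖) hne
      have hjT : j ∉ T := (Finset.mem_sdiff.1 hj).2
      calc ∑ i ∈ R \ T, ‖x i‖ ^ 2 ≤ (R \ T).card • ‖x j‖ ^ 2 :=
            Finset.sum_le_card_nsmul _ _ _ fun i hi =>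
              pow_le_pow_left₀ (norm_nonneg _) (hjmax i hi) 2
        _ ≤ (T \ R).card • ‖x j‖ ^ 2 := by gcongr
        _ ≤ ∑ i ∈ T \ R, ‖x i‖ ^ 2 := Finset.card_nsmul_le_sum _ _ _ fun i hi =>
              pow_le_pow_left₀ (norm_nonneg _) (hmax i (Finset.mem_sdiff.1 hi).1 j hjT) 2
  rw [l2_restrictTo_sq, ← Finset.sum_inter_add_sum_sdiff R T,
    ← Finset.sum_inter_add_sum_sdiff T R, Finset.inter_comm]
  gcongr

/-- A best `s`-sparse approximation of `x` is at least as close to `x` as any `s`-sparse vector. -/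
lemma IsSparseApprox.l2_sub_le {N s : ℕ} {x y z : Fin N → ℂ} (h : IsSparseApprox s x y)
    (hz : Sparse s z) : l2 (x - y) ≤ l2 (x - z) := by
  refine (sq_le_sq₀ (l2_nonneg _) (l2_nonneg _)).1 ?_
  have h1 : l2 (x - y) ^ 2 + l2 y ^ 2 = l2 x ^ 2 := by
    obtain ⟨T, -, rfl, -⟩ := h
    simp only [l2_sq, ← Finset.sum_add_distrib]
    refine Finset.sum_congr rfl fun i _ => ?_
    by_cases hi : i ∈ T <;> simp [restrictTo, hi]
  have h2 : l2 x ^ 2 ≤ l2 (x - z) ^ 2 + ∑ i ∈ suppF z, ‖x i‖ ^ 2 := by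
    rw [← l2_restrictTo_sq, l2_sq, l2_sq, l2_sq, ← Finset.sum_add_distrib]
    refine Finset.sum_le_sum fun i _ => ?_
    by_cases hi : i ∈ suppF z
    · simp [restrictTo, hi]
    · simp [restrictTo, hi, not_not.1 (mt mem_suppF.2 hi)]
  have h3 := h.sum_le_l2_sq hz
  linarith

/-- The restricted isometry inequalities of order `r` with constant `δ`. -/
def RIPWith {m N : ℕ} (Φ : Matrix (Fin m) (Fin N) ℂ) (r : ℕ) (δ : ℝ) : Prop :=
  0 ≤ δ ∧ ∀ x : Fin N → ℂ, Sparse r x →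
    (1 - δ) * l2 x ^ 2 ≤ l2 (Φ.mulVec x) ^ 2 ∧ l2 (Φ.mulVec x) ^ 2 ≤ (1 + δ) * l2 x ^ 2

lemma exists_ripWith {m N : ℕ} (Φ : Matrix (Fin m) (Fin N) ℂ) (r : ℕ) :
    ∃ δ, RIPWith Φ r δ := by
  let L := LinearMap.toContinuousLinearMap (Matrix.toLpLin 2 2 Φ)
  refine ⟨max 1 (‖L‖ ^ 2), zero_le_one.trans (le_max_left _ _), fun x _ => ⟨?_, ?_⟩⟩
  · have := le_max_left (1 : ℝ) (‖L‖ ^ 2)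
    exact (mul_nonpos_of_nonpos_of_nonneg (by linarith) (sq_nonneg _)).trans (sq_nonneg _)
  · have h : l2 (Φ.mulVec x) ≤ ‖L‖ * l2 x := by
      simpa [l2_eq_norm, L] using L.le_opNorm (WithLp.toLp 2 x)
    calc l2 (Φ.mulVec x) ^ 2 ≤ (‖L‖ * l2 x) ^ 2 := pow_le_pow_left₀ (l2_nonneg _) h 2
      _ = ‖L‖ ^ 2 * l2 x ^ 2 := mul_pow _ _ _
      _ ≤ (1 + max 1 (‖L‖ ^ 2)) * l2 x ^ 2 := by
        gcongr
        have := le_max_right (1 : ℝ) (‖L‖ ^ 2)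
        linarith

lemma exists_ripWith_lt {m N : ℕ} {Φ : Matrix (Fin m) (Fin N) ℂ} {r : ℕ} {c : ℝ}
    (h : RIC Φ r < c) : ∃ δ < c, RIPWith Φ r δ := by
  obtain ⟨δ, hδ, hlt⟩ := exists_lt_of_csInf_lt (exists_ripWith Φ r) h
  exact ⟨δ, hlt, hδ⟩

/-- The polarized form of the restricted isometry inequalities. -/
lemma RIPWith.re_dotProduct_sub_le {m N r : ℕ} {Φ : Matrix (Fin m) (Fin N) ℂ} {δ : ℝ}
    (h : RIPWith Φ r δ) {S : Finset (Fin N)} (hS : S.card ≤ r) {v w : Fin N → ℂ}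
    (hv : suppF v ⊆ S) (hw : suppF w ⊆ S) :
    (star (Φ.mulVec w) ⬝ᵥ Φ.mulVec v).re - (star w ⬝ᵥ v).re ≤ δ * l2 v * l2 w := by
  have hvS : ∀ i ∉ S, v i = 0 := fun i hi => not_not.1 (mt mem_suppF.2 fun h => hi (hv h))
  have hwS : ∀ i ∉ S, w i = 0 := fun i hi => not_not.1 (mt mem_suppF.2 fun h => hi (hw h))
  rcases (l2_nonneg v).eq_or_lt with hv0 | hv0
  · rw [l2_eq_zero.1 hv0.symm]
    simp [l2]
  rcases (l2_nonneg w).eq_or_lt with hw0 | hw0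
  · rw [l2_eq_zero.1 hw0.symm]
    simp [l2]
  set p : Fin N → ℂ := ((l2 v : ℝ) : ℂ) • w with hp
  set q : Fin N → ℂ := ((l2 w : ℝ) : ℂ) • v with hq
  have hadd : Sparse r (p + q) := .of_suppF_subset (S := S) (fun i hi => by
    by_contra hiS
    exact mem_suppF.1 hi (by simp [hp, hq, hvS i hiS, hwS i hiS])) hS
  have hsub : Sparse r (p - q) := .of_suppF_subset (S := S) (fun i hi => by
    by_contra hiS
    exact mem_suppF.1 hi (by simp [hp, hq, hvS i hiS, hwS i hiS])) hS
  have h1 := (h.2 _ hadd).2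
  have h2 := (h.2 _ hsub).1
  rw [mulVec_add, l2_add_sq, l2_add_sq] at h1
  rw [mulVec_sub, l2_sub_sq, l2_sub_sq] at h2
  have hpn : l2 p = l2 v * l2 w := by rw [hp, l2_smul, abs_of_pos hv0]
  have hqn : l2 q = l2 v * l2 w := by rw [hq, l2_smul, abs_of_pos hw0, mul_comm]
  have e1 : (star p ⬝ᵥ q).re = l2 v * l2 w * (star w ⬝ᵥ v).re := by
    simp [hp, hq, star_smul, smul_dotProduct, dotProduct_smul, mul_assoc, mul_left_comm]
  have e2 : (star (Φ.mulVec p) ⬝ᵥ Φ.mulVec q).re =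
      l2 v * l2 w * (star (Φ.mulVec w) ⬝ᵥ Φ.mulVec v).re := by
    simp [hp, hq, mulVec_smul, star_smul, smul_dotProduct, dotProduct_smul, mul_assoc,
      mul_left_comm]
  rw [e1, e2, hpn, hqn] at h1 h2
  have hpos : 0 < l2 v * l2 w := mul_pos hv0 hw0
  refine le_of_mul_le_mul_left ?_ hpos
  nlinarith

/-- The proxy `Φ* (Φ v + e)` approximates `v` on every small set of coordinates. -/
lemma RIPWith.l2_restrictTo_proxy_sub_le {m N r : ℕ} {Φ : Matrix (Fin m) (Fin N) ℂ} {δ : ℝ}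
    (h : RIPWith Φ r δ) {S : Finset (Fin N)} {v : Fin N → ℂ} (hS : (suppF v ∪ S).card ≤ r)
    (e : Fin m → ℂ) :
    l2 (restrictTo (Φᴴ.mulVec (Φ.mulVec v + e) - v) S) ≤ δ * l2 v + √(1 + δ) * l2 e := by
  set g := Φᴴ.mulVec (Φ.mulVec v + e) - v with hg
  set w := restrictTo g S with hw
  have hwS : suppF w ⊆ S := suppF_restrictTo_subset _ _
  have h1 : l2 w ^ 2 = (star w ⬝ᵥ g).re := by
    rw [l2_sq_eq_re_dotProduct]
    congr 1
    refine Finset.sum_congr rfl fun i _ => ?_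
    by_cases hi : i ∈ S <;> simp [hw, restrictTo, hi]
  have h2 : star w ⬝ᵥ g = star (Φ.mulVec w) ⬝ᵥ Φ.mulVec v + star (Φ.mulVec w) ⬝ᵥ e -
      star w ⬝ᵥ v := by
    rw [hg, dotProduct_sub, dotProduct_mulVec, ← star_mulVec, dotProduct_add]
  have h3 := h.re_dotProduct_sub_le hS Finset.subset_union_left
    (hwS.trans Finset.subset_union_right)
  have h4 : l2 (Φ.mulVec w) ≤ √(1 + δ) * l2 w := by
    refine (sq_le_sq₀ (l2_nonneg _) (by have := l2_nonneg w; positivity)).1 ?_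
    rw [mul_pow, Real.sq_sqrt (by linarith [h.1])]
    exact (h.2 w (.of_suppF_subset (hwS.trans Finset.subset_union_right) hS)).2
  have h5 := (re_dotProduct_le_l2_mul (Φ.mulVec w) e).trans
    (mul_le_mul_of_nonneg_right h4 (l2_nonneg e))
  rw [h2, Complex.sub_re, Complex.add_re] at h1
  have h6 : l2 w * l2 w ≤ l2 w * (δ * l2 v + √(1 + δ) * l2 e) := by linarith
  rcases (l2_nonneg w).eq_or_lt with h0 | h0
  · rw [← h0]
    have := h.1
    have := l2_nonneg v
    have := l2_nonneg e
    positivity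
  · exact le_of_mul_le_mul_left h6 h0

lemma colSub_mulVec {m N : ℕ} (Φ : Matrix (Fin m) (Fin N) ℂ) (T : Finset (Fin N))
    (c : {i // i ∈ T} → ℂ) :
    (colSub Φ T).mulVec c = Φ.mulVec fun j => if h : j ∈ T then c ⟨j, h⟩ else 0 := by
  ext i
  simp only [mulVec, dotProduct, colSub, of_apply]
  rw [← Finset.sum_subset (Finset.subset_univ T) (fun j _ hj => by simp [hj]),
    ← Finset.sum_coe_sort T]
  exact Finset.sum_congr rfl fun j _ => by simp

lemma suppF_pinvApply_subset {m N : ℕ} (Φ : Matrix (Fin m) (Fin N) ℂ) (T : Finset (Fin N))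
    (u : Fin m → ℂ) : suppF (pinvApply Φ T u) ⊆ T := by
  intro i hi
  by_contra h
  exact mem_suppF.1 hi (by simp [pinvApply, h])

open scoped ComplexOrder in
/-- The normal equations: the least-squares residual is orthogonal to the selected columns. -/
lemma RIPWith.restrictTo_residual_eq_zero {m N r : ℕ} {Φ : Matrix (Fin m) (Fin N) ℂ} {δ : ℝ}
    (h : RIPWith Φ r δ) (hδ : δ < 1) {T : Finset (Fin N)} (hT : T.card ≤ r) (u : Fin m → ℂ) :
    restrictTo (Φᴴ.mulVec (u - Φ.mulVec (pinvApply Φ T u))) T = 0 := by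
  set A := colSub Φ T with hA
  have hinj : Function.Injective (Aᴴ * A).mulVec := by
    refine (injective_iff_map_eq_zero (Aᴴ * A).mulVecLin).2 fun c hc => ?_
    have hc' : A.mulVec c = 0 := conjTranspose_mul_self_mulVec_eq_zero _ _ |>.1 hc
    rw [hA, colSub_mulVec] at hc'
    set z : Fin N → ℂ := fun j => if h : j ∈ T then c ⟨j, h⟩ else 0 with hz
    have hzs : Sparse r z := .of_suppF_subset (S := T) (fun i hi => by
      by_contra hiT
      exact mem_suppF.1 hi (by simp [hz, hiT])) hT
    have h1 := (h.2 z hzs).1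
    rw [hc', l2_eq_zero.2 rfl] at h1
    have h2 : z = 0 := l2_eq_zero.1 (pow_eq_zero_iff two_ne_zero |>.1 (by nlinarith [l2_nonneg z]))
    ext j
    simpa [hz] using congrFun h2 j.1
  have hdet : IsUnit (Aᴴ * A).det :=
    (isUnit_iff_isUnit_det _).1 (mulVec_injective_iff_isUnit.1 hinj)
  have hpinv : Φ.mulVec (pinvApply Φ T u) = A.mulVec (((Aᴴ * A)⁻¹ * Aᴴ).mulVec u) :=
    (colSub_mulVec Φ T _).symm
  have hnormal : Aᴴ.mulVec (u - Φ.mulVec (pinvApply Φ T u)) = 0 := by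
    rw [hpinv, mulVec_sub, mulVec_mulVec, mulVec_mulVec, ← Matrix.mul_assoc,
      mul_nonsing_inv _ hdet, Matrix.one_mul, sub_self]
  ext j
  by_cases hj : j ∈ T
  · simpa [restrictTo, hj, mulVec, dotProduct, hA, colSub] using congrFun hnormal ⟨j, hj⟩
  · simp [restrictTo, hj]

/-- Identification: the coordinates selected from the proxy capture most of the energy. -/
lemma RIPWith.l2_restrictTo_compl_le {m N s : ℕ} {Φ : Matrix (Fin m) (Fin N) ℂ} {δ : ℝ}
    (h : RIPWith Φ (4 * s) δ) {v y : Fin N → ℂ} {e : Fin m → ℂ} (hv : Sparse (2 * s) v)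
    (hy : IsSparseApprox (2 * s) (Φᴴ.mulVec (Φ.mulVec v + e)) y) :
    l2 (restrictTo v (suppF y)ᶜ) ≤ 2 * (δ * l2 v + √(1 + δ) * l2 e) := by
  set p := Φᴴ.mulVec (Φ.mulVec v + e) with hp
  set R := suppF v with hR
  set W := suppF y with hW
  have hvR : ∀ i ∉ R, v i = 0 := fun i hi => not_not.1 (mt mem_suppF.2 hi)
  have hRc : R.card ≤ 2 * s := hv
  have hWc : W.card ≤ 2 * s := hy.sparse
  have hcard : ∀ S ⊆ R ∪ W, (R ∪ S).card ≤ 4 * s := fun S hS =>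
    (Finset.card_le_card (Finset.union_subset Finset.subset_union_left hS)).trans
      ((Finset.card_union_le _ _).trans (by omega))
  have h1 := h.l2_restrictTo_proxy_sub_le
    (hcard (R \ W) (Finset.sdiff_subset.trans Finset.subset_union_left)) e
  have h2 := h.l2_restrictTo_proxy_sub_le
    (hcard (W \ R) (Finset.sdiff_subset.trans Finset.subset_union_right)) e
  have h3 : l2 (restrictTo p (R \ W)) ≤ l2 (restrictTo p (W \ R)) := by
    refine (sq_le_sq₀ (l2_nonneg _) (l2_nonneg _)).1 ?_
    have h4 := hy.sum_le_l2_sq hRc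
    rw [hy.eq_restrictTo_suppF, l2_restrictTo_sq, ← hW, ← Finset.sum_inter_add_sum_sdiff R W,
      ← Finset.sum_inter_add_sum_sdiff W R, Finset.inter_comm] at h4
    rw [l2_restrictTo_sq, l2_restrictTo_sq]
    linarith
  have h5 : restrictTo p (W \ R) = restrictTo (p - v) (W \ R) := by
    ext i
    by_cases hi : i ∈ R <;> simp [restrictTo, hi, hvR]
  have h6 : restrictTo v Wᶜ = restrictTo p (R \ W) + -restrictTo (p - v) (R \ W) := by
    ext i
    by_cases hi : i ∈ R <;> by_cases hi' : i ∈ W <;> simp [restrictTo, hi, hi', hvR]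
  rw [h5] at h3
  calc l2 (restrictTo v Wᶜ)
      ≤ l2 (restrictTo p (R \ W)) + l2 (restrictTo (p - v) (R \ W)) := by
        rw [h6, ← l2_neg (restrictTo (p - v) (R \ W))]
        exact l2_add_le _ _
    _ ≤ _ := by linarith

/-- Estimation: the least-squares error is controlled by the part of the signal missed by `T`. -/
lemma RIPWith.l2_sub_pinvApply_le {m N r : ℕ} {Φ : Matrix (Fin m) (Fin N) ℂ} {δ : ℝ}
    (h : RIPWith Φ r δ) (hδ : δ < 1) {x : Fin N → ℂ} {T : Finset (Fin N)}
    (hT : (suppF x ∪ T).card ≤ r) (e : Fin m → ℂ) :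
    (1 - δ) * l2 (x - pinvApply Φ T (Φ.mulVec x + e)) ≤
      l2 (restrictTo x Tᶜ) + √(1 + δ) * l2 e := by
  set b := pinvApply Φ T (Φ.mulVec x + e) with hb
  have hbT : suppF b ⊆ T := suppF_pinvApply_subset _ _ _
  have hd : suppF (x - b) ∪ T ⊆ suppF x ∪ T :=
    Finset.union_subset ((suppF_sub_subset x b).trans (Finset.union_subset_union_right hbT))
      Finset.subset_union_right
  have h1 := h.l2_restrictTo_proxy_sub_le ((Finset.card_le_card hd).trans hT) e
  have h2 := h.restrictTo_residual_eq_zero hδ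
    ((Finset.card_le_card Finset.subset_union_right).trans hT) (Φ.mulVec x + e)
  rw [← hb, show Φ.mulVec x + e - Φ.mulVec b = Φ.mulVec (x - b) + e by
    rw [mulVec_sub]; abel] at h2
  rw [sub_eq_add_neg (Φᴴ.mulVec _), restrictTo_add, h2, zero_add] at h1
  have h3 : x - b = restrictTo x Tᶜ + -restrictTo (-(x - b)) T := by
    ext i
    by_cases hi : i ∈ T
    · simp [restrictTo, hi]
    · simp [restrictTo, hi, not_not.1 (mt mem_suppF.2 fun h => hi (hbT h))]
  have h4 : l2 (x - b) ≤ l2 (restrictTo x Tᶜ) + l2 (restrictTo (-(x - b)) T) := by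
    rw [← l2_neg (restrictTo (-(x - b)) T)]
    exact (congrArg l2 h3).trans_le (l2_add_le _ _)
  linarith

/-- One CoSaMP iteration, with the error bound expressed through the restricted isometry
constant. -/
lemma RIPWith.l2_sub_coSaMPStep_le {m N s : ℕ} {Φ : Matrix (Fin m) (Fin N) ℂ} {δ : ℝ}
    (h : RIPWith Φ (4 * s) δ) (hδ : δ < 1) {x a a' : Fin N → ℂ} {e : Fin m → ℂ}
    (hx : Sparse s x) (ha : Sparse s a) (hstep : CoSaMPStep Φ (Φ.mulVec x + e) s a a') :
    (1 - δ) * l2 (x - a') ≤ 4 * δ * l2 (x - a) + 6 * √(1 + δ) * l2 e := by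
  obtain ⟨y, hy, ha'⟩ := hstep
  rw [show Φ.mulVec x + e - Φ.mulVec a = Φ.mulVec (x - a) + e by
    rw [mulVec_sub]; abel] at hy
  set T := suppF y ∪ suppF a with hT
  set b := pinvApply Φ T (Φ.mulVec x + e)
  have hxc : (suppF x).card ≤ s := hx
  have hac : (suppF a).card ≤ s := ha
  have hyc : (suppF y).card ≤ 2 * s := hy.sparse
  have hTc : (suppF x ∪ T).card ≤ 4 * s := by
    have h1 := Finset.card_union_le (suppF x) T
    have h2 := Finset.card_union_le (suppF y) (suppF a)
    rw [← hT] at h2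
    omega
  have hr : Sparse (2 * s) (x - a) := .of_suppF_subset (suppF_sub_subset x a)
    ((Finset.card_union_le _ _).trans (by omega))
  have hident := h.l2_restrictTo_compl_le hr hy
  have hest := h.l2_sub_pinvApply_le hδ hTc e
  have hmono : l2 (restrictTo x Tᶜ) ≤ l2 (restrictTo (x - a) (suppF y)ᶜ) := by
    refine l2_le_l2_of_norm_le fun i => ?_
    by_cases hy' : i ∈ suppF y <;> by_cases ha0 : a i = 0 <;>
      simp [restrictTo, hT, hy', mem_suppF, ha0]
  have hprune : l2 (x - a') ≤ 2 * l2 (x - b) := by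
    have h1 := ha'.l2_sub_le hx
    have h2 := l2_add_le (x - b) (b - a')
    rw [sub_add_sub_cancel] at h2
    rw [← l2_neg (b - x), neg_sub] at h1
    linarith
  nlinarith

/-- **CoSaMP iteration invariant (sparse signals).**  If `Φ` has restricted isometry
constant `δ_{4s} ≤ 0.1`, `x` is `s`-sparse, and `u = Φx + e`, then every CoSaMP
approximation `a^k` is `s`-sparse and `‖x − a^{k+1}‖₂ ≤ 0.5‖x − a^k‖₂ + 7.5‖e‖₂`. -/
theorem cosamp_iteration_invariant_sparse
    {m N : ℕ} (s : ℕ) (hs : 0 < s)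
    (Φ : Matrix (Fin m) (Fin N) ℂ) (hΦ : RIC Φ (4 * s) ≤ 0.1)
    (x : Fin N → ℂ) (hx : Sparse s x) (e : Fin m → ℂ)
    (u : Fin m → ℂ) (hu : u = Φ.mulVec x + e)
    (a : ℕ → Fin N → ℂ) (ha : CoSaMPSeq Φ u s a) :
    ∀ k : ℕ, Sparse s (a k) ∧
      l2 (x - a (k + 1)) ≤ 0.5 * l2 (x - a k) + 7.5 * l2 e := by
  subst hu
  obtain ⟨δ, hδ, hrip⟩ := exists_ripWith_lt (c := 0.101) (hΦ.trans_lt (by norm_num))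
  have hsparse : ∀ k, Sparse s (a k) := by
    rintro (_ | k)
    · simp [ha.1, Sparse, suppF]
    · obtain ⟨y, -, h⟩ := ha.2 k
      exact h.sparse
  refine fun k => ⟨hsparse k, ?_⟩
  norm_num at hδ ⊢
  have hstep := hrip.l2_sub_coSaMPStep_le (by linarith) hx (hsparse k) (ha.2 k)
  have hsqrt : √(1 + δ) ≤ 1.05 := Real.sqrt_le_iff.2 ⟨by norm_num, by norm_num; linarith⟩
  have h1 := l2_nonneg (x - a (k + 1))
  have h2 := mul_le_mul_of_nonneg_right hδ.le (l2_nonneg (x - a k))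
  have h3 := mul_le_mul_of_nonneg_right hδ.le h1
  have h4 := mul_le_mul_of_nonneg_right hsqrt (l2_nonneg e)
  norm_num at h4
  have h5 := l2_nonneg (x - a k)
  have h6 := l2_nonneg e
  linarith
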